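/- arXiv:1512.09232 — 2 statements merged into one kernel-verified Lean document; each statement's English description precedes it below -/
import Mathlib

section
/- The collection 𝒞 = {C_U ∪ C_{σ(U)} : U ∈ Gr_e(H)} is an equitable partition of the subgraph of the Grassmann graph J_q(2e+1,e+1) induced on A. -/
/-- A partition `P` of the vertex set of a graph `G` is *equitable* if for all cells
`C, C' ∈ P` there is a constant `m` such that every vertex of `C'` has exactly `m`
neighbors in `C`. -/
def IsEquitablePartition {X : Type*} (G : SimpleGraph X) (P : Set (Set X)) : Prop :=
  Setoid.IsPartition P ∧
    ∀ C ∈ P, ∀ C' ∈ P, ∃ m : ℕ, ∀ x ∈ C', (G.neighborSet x ∩ C).ncard = m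

section helpers
variable {F : Type*} [Field F] {V : Type*} [AddCommGroup V] [Module F V] [FiniteDimensional F V]

lemma aux_anti_le (σ : Submodule F V → Submodule F V) (hs : StrictAnti σ) :
    ∀ n (U : Submodule F V), Module.finrank F U = n →
      Module.finrank F (σ U) + n ≤ Module.finrank F V := by
  intro n
  induction n with
  | zero => intro U _; simpa using Submodule.finrank_le (σ U)
  | succ n ih =>
    intro U hU
    obtain ⟨U', hlt, hf⟩ : ∃ U' : Submodule F V, U' < U ∧ Module.finrank F U' = n := by
      obtain ⟨f, hf⟩ := exists_linearIndependent_of_le_finrank (R := F) (M := U) (n := n) (by omega)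
      refine ⟨(Submodule.span F (Set.range f)).map U.subtype, ?_, ?_⟩
      · have h1 : (Submodule.span F (Set.range f)).map U.subtype ≤ U := Submodule.map_subtype_le _ _
        refine lt_of_le_of_ne h1 fun h => ?_
        have : Module.finrank F ((Submodule.span F (Set.range f)).map U.subtype) = n := by
          rw [Submodule.finrank_map_subtype_eq, finrank_span_eq_card hf]; simp
        rw [h] at this; omega
      · rw [Submodule.finrank_map_subtype_eq, finrank_span_eq_card hf]; simp
    have := ih U' hf
    have := Submodule.finrank_lt_finrank_of_lt (hs hlt)
    omega

lemma aux_anti_ge (σ : Submodule F V → Submodule F V) (hs : StrictAnti σ) :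
    ∀ n (U : Submodule F V), Module.finrank F U + n = Module.finrank F V →
      n ≤ Module.finrank F (σ U) := by
  intro n
  induction n with
  | zero => intro U _; simp
  | succ n ih =>
    intro U hU
    have hne : U ≠ ⊤ := by rintro rfl; simp at hU
    obtain ⟨v, hv⟩ : ∃ v, v ∉ U := by
      by_contra! h; exact hne (Submodule.eq_top_iff'.2 h)
    have hlt : U < U ⊔ Submodule.span F {v} := by
      refine lt_of_le_of_ne le_sup_left fun h => hv ?_
      rw [h]; exact Submodule.mem_sup_right (Submodule.mem_span_singleton_self v)
    have h1 := Submodule.finrank_lt_finrank_of_lt hlt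
    have h2 := Submodule.finrank_add_le_finrank_add_finrank U (Submodule.span F {v})
    have h3 := finrank_span_le_card (R := F) ({v} : Set V)
    simp at h3
    have := ih (U ⊔ Submodule.span F {v}) (by omega)
    have := Submodule.finrank_lt_finrank_of_lt (hs hlt)
    omega

lemma aux_polarity (σ : Submodule F V → Submodule F V) (hi : ∀ U, σ (σ U) = U)
    (ha : ∀ U U', U ≤ U' → σ U' ≤ σ U) :
    (∀ U, Module.finrank F (σ U) + Module.finrank F U = Module.finrank F V) ∧
    (∀ U U' : Submodule F V, Module.finrank F U + Module.finrank F U' = Module.finrank F V →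
      Module.finrank F ↥(σ U ⊓ σ U') = Module.finrank F ↥(U ⊓ U')) := by
  have hs : StrictAnti σ := by
    intro U U' h
    refine lt_of_le_of_ne (ha _ _ h.le) fun h' => h.ne ?_
    rw [← hi U, ← h', hi]
  have h1 : ∀ U, Module.finrank F (σ U) + Module.finrank F U = Module.finrank F V := by
    intro U
    have a := aux_anti_le σ hs _ U rfl
    have c := Submodule.finrank_le U
    have b := aux_anti_ge σ hs (Module.finrank F V - Module.finrank F U) U (by omega)
    omega
  refine ⟨h1, fun U U' h => ?_⟩
  have h2 : σ U ⊓ σ U' = σ (U ⊔ U') := by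
    apply le_antisymm
    · rw [← hi (σ U ⊓ σ U')]
      apply ha
      apply sup_le
      · rw [← hi U]; apply ha; rw [hi]; exact inf_le_left
      · rw [← hi U']; apply ha; rw [hi]; exact inf_le_right
    · exact le_inf (ha _ _ le_sup_left) (ha _ _ le_sup_right)
  rw [h2]
  have := h1 (U ⊔ U')
  have := Submodule.finrank_sup_add_finrank_inf_eq U U'
  omega

lemma aux_range [Fintype F] {X : Type*} (f : V → X) (p : Submodule F V)
    (h : ∀ a b, f a = f b ↔ a - b ∈ p) :
    (Set.range f).ncard = Fintype.card F ^ (Module.finrank F V - Module.finrank F p) := by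
  have : Finite V := Module.finite_of_finite F
  let g : V ⧸ p → X := fun a => f (Quotient.out a)
  have hg : ∀ a, g (Submodule.Quotient.mk a) = f a := by
    intro a
    rw [h, ← Submodule.Quotient.eq]
    exact Quotient.out_eq _
  have hgi : Function.Injective g := by
    intro a b
    obtain ⟨a, rfl⟩ := Submodule.Quotient.mk_surjective p a
    obtain ⟨b, rfl⟩ := Submodule.Quotient.mk_surjective p b
    rw [hg, hg, h, Submodule.Quotient.eq]; exact id
  have hr : Set.range f = Set.range g := by
    ext y; constructor
    · rintro ⟨a, rfl⟩; exact ⟨_, hg a⟩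
    · rintro ⟨a, rfl⟩; exact ⟨_, rfl⟩
  rw [hr, ← Nat.card_coe_set_eq, Nat.card_range_of_injective hgi,
    Module.natCard_eq_pow_finrank (K := F), Nat.card_eq_fintype_card]
  have := p.finrank_quotient_add_finrank
  congr 1; omega

/-- `S + ⟨v⟩`. -/
def KK {H : Submodule F V} (S : Submodule F H) (v : V) : Submodule F V :=
  S.map H.subtype ⊔ Submodule.span F {v}

lemma mem_KK {H : Submodule F V} (S : Submodule F H) (v w : V) :
    w ∈ KK S v ↔ ∃ s ∈ S, ∃ c : F, w = (s : V) + c • v := by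
  unfold KK
  simp only [Submodule.mem_sup, Submodule.mem_map, Submodule.mem_span_singleton]
  constructor
  · rintro ⟨_, ⟨s, hs, rfl⟩, _, ⟨c, rfl⟩, rfl⟩; exact ⟨s, hs, c, rfl⟩
  · rintro ⟨s, hs, c, rfl⟩; exact ⟨_, ⟨s, hs, rfl⟩, _, ⟨c, rfl⟩, rfl⟩

lemma aux_coeff {H : Submodule F V} {v : V} (hv : v ∉ H) {c : F} {h : V} (hh : h ∈ H)
    (hc : h + c • v ∈ H) : c = 0 := by
  by_contra h0
  apply hv
  have : c • v ∈ H := by simpa using H.sub_mem hc hh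
  exact (H.smul_mem_iff h0).1 this

lemma comap_KK {H : Submodule F V} (S : Submodule F H) {v : V} (hv : v ∉ H) :
    Submodule.comap H.subtype (KK S v) = S := by
  ext y
  simp only [Submodule.mem_comap, Submodule.subtype_apply, mem_KK]
  constructor
  · rintro ⟨s, hs, c, h⟩
    have := aux_coeff hv s.2 (h ▸ y.2)
    subst this
    have : y = s := by ext; simpa using h
    rwa [this]
  · intro hy; exact ⟨y, hy, 0, by simp⟩

lemma self_mem_KK {H : Submodule F V} (S : Submodule F H) (v : V) : v ∈ KK S v :=
  (mem_KK S v v).2 ⟨0, S.zero_mem, 1, by simp⟩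

lemma KK_eq_iff {H : Submodule F V} (S : Submodule F H) {v : V} (hv : v ∉ H) (a b : H) :
    KK S (v + a) = KK S (v + b) ↔ a - b ∈ S := by
  have key : ∀ a b : H, a - b ∈ S → KK S (v + a) ≤ KK S (v + b) := by
    intro a b h w hw
    rw [mem_KK] at hw ⊢
    obtain ⟨s, hs, c, rfl⟩ := hw
    refine ⟨s + c • (a - b), S.add_mem hs (S.smul_mem _ h), c, ?_⟩
    push_cast
    module
  constructor
  · intro h
    have h1 := self_mem_KK S (v + a)
    rw [h, mem_KK] at h1
    obtain ⟨s, hs, c, h1⟩ := h1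
    have h2 : (1 - c) = 0 := by
      apply aux_coeff hv (h := 0) H.zero_mem
      have : (0 : V) + (1 - c) • v = ((s + c • b - a : H) : V) := by
        push_cast
        have : v + (a : V) - a = (s + c • (v + b)) - a := by rw [h1]
        rw [add_sub_cancel_right] at this
        have h4 : (1 - c) • v = v - c • v := by module
        rw [zero_add, h4]
        nth_rewrite 1 [this]
        module
      rw [this]; exact (s + c • b - a : H).2
    have h3 : c = 1 := by linear_combination -h2
    subst h3
    have : a - b = s := by
      ext; push_cast
      rw [one_smul] at h1
      have h5 : (a : V) - b = (v + a) - (v + b) := by module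
      rw [h5, h1]; module
    rwa [this]
  · intro h
    exact le_antisymm (key a b h) (key b a (by simpa using S.neg_mem h))

lemma aux_top {H : Submodule F V} (hd : Module.finrank F V = Module.finrank F H + 1)
    {W : Submodule F V} (hW : ¬ W ≤ H) : W ⊔ H = ⊤ := by
  apply Submodule.eq_top_of_finrank_eq
  have : H < W ⊔ H := lt_of_le_of_ne le_sup_right fun h => hW (by rw [h]; exact le_sup_left)
  have := Submodule.finrank_lt_finrank_of_lt this
  have := Submodule.finrank_le (W ⊔ H)
  omega

lemma finrank_comap_eq (H W : Submodule F V) :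
    Module.finrank F (Submodule.comap H.subtype W) = Module.finrank F ↥(W ⊓ H) := by
  rw [← Submodule.finrank_map_subtype_eq H, Submodule.map_comap_subtype, inf_comm]

lemma finrank_A {H : Submodule F V} (hd : Module.finrank F V = Module.finrank F H + 1)
    {W : Submodule F V} (hW : ¬ W ≤ H) :
    Module.finrank F W = Module.finrank F (Submodule.comap H.subtype W) + 1 := by
  have h := Submodule.finrank_sup_add_finrank_inf_eq W H
  rw [aux_top hd hW, finrank_top] at h
  rw [finrank_comap_eq]; omega

lemma aux_decomp {H : Submodule F V} (hd : Module.finrank F V = Module.finrank F H + 1)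
    {v : V} (hv : v ∉ H) (w : V) : ∃ h : H, ∃ c : F, w = h + c • v := by
  have : w ∈ Submodule.span F {v} ⊔ H := by
    rw [aux_top hd (by simpa using hv)]; trivial
  obtain ⟨a, ha, b, hb, rfl⟩ := Submodule.mem_sup.1 this
  obtain ⟨c, rfl⟩ := Submodule.mem_span_singleton.1 ha
  exact ⟨⟨b, hb⟩, c, add_comm _ _⟩

lemma eq_KK {H : Submodule F V} (hd : Module.finrank F V = Module.finrank F H + 1)
    {W : Submodule F V} {v : V} (hv : v ∉ H) (hvW : v ∈ W) :
    W = KK (Submodule.comap H.subtype W) v := by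
  ext w
  rw [mem_KK]
  constructor
  · intro hw
    obtain ⟨h, c, rfl⟩ := aux_decomp hd hv w
    refine ⟨h, ?_, c, rfl⟩
    simpa using W.sub_mem hw (W.smul_mem c hvW)
  · rintro ⟨s, hs, c, rfl⟩
    exact W.add_mem hs (W.smul_mem c hvW)

lemma KK_not_le {H : Submodule F V} (S : Submodule F H) {v : V} (hv : v ∉ H) : ¬ KK S v ≤ H :=
  fun h => hv (h (self_mem_KK S v))

lemma finrank_KK {H : Submodule F V} (hd : Module.finrank F V = Module.finrank F H + 1)
    (S : Submodule F H) {v : V} (hv : v ∉ H) :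
    Module.finrank F (KK S v) = Module.finrank F S + 1 := by
  rw [finrank_A hd (KK_not_le S hv), comap_KK S hv]

lemma aux_add_not_mem {H : Submodule F V} {v : V} (hv : v ∉ H) (a : H) : v + a ∉ H :=
  fun h => hv (by simpa using H.sub_mem h a.2)

/-- The vertex set. -/
abbrev AA (H : Submodule F V) (e : ℕ) :=
  {W : Submodule F V // Module.finrank F ↥W = e + 1 ∧ ¬ W ≤ H}

/-- The number of neighbours as a function of the dimension of the intersection. -/
def gg (q e d : ℕ) : ℕ := if d = e then q ^ e - 1 else if d + 1 = e then q else 0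

lemma count_nbrs [Fintype F] (e : ℕ) {H : Submodule F V}
    (hd : Module.finrank F V = Module.finrank F H + 1) (hH : Module.finrank F H = 2 * e)
    (x : AA H e) (S : Submodule F H) (hS : Module.finrank F S = e) :
    ((SimpleGraph.fromRel fun W₁ W₂ : AA H e =>
      Module.finrank F ↥(W₁.1 ⊓ W₂.1) = e).neighborSet x ∩
      {W | Submodule.comap H.subtype W.1 = S}).ncard =
    gg (Fintype.card F) e (Module.finrank F ↥(Submodule.comap H.subtype x.1 ⊓ S)) := by
  have : Finite V := Module.finite_of_finite F
  obtain ⟨v, hvx, hv⟩ : ∃ v ∈ x.1, v ∉ H := by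
    simpa [SetLike.le_def] using x.2.2
  have hx := finrank_A hd x.2.2
  have hT : Module.finrank F (Submodule.comap H.subtype x.1) = e := by have := x.2.1; omega
  have hxK := eq_KK hd hv hvx
  set T := Submodule.comap H.subtype x.1 with hTdef
  have hadj : ∀ W : AA H e, W ∈ (SimpleGraph.fromRel fun W₁ W₂ : AA H e =>
      Module.finrank F ↥(W₁.1 ⊓ W₂.1) = e).neighborSet x ↔
      x ≠ W ∧ Module.finrank F ↥(x.1 ⊓ W.1) = e := by
    intro W
    rw [SimpleGraph.mem_neighborSet, SimpleGraph.fromRel_adj, inf_comm W.1, or_self]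
  let f : H → AA H e := fun h => ⟨KK S (v + h),
    by rw [finrank_KK hd S (aux_add_not_mem hv h), hS], KK_not_le S (aux_add_not_mem hv h)⟩
  have hf : ∀ a b, f a = f b ↔ a - b ∈ S := by
    intro a b
    rw [← KK_eq_iff S hv, Subtype.ext_iff]
  have hfc : ∀ a, Submodule.comap H.subtype (f a).1 = S := fun a =>
    comap_KK S (aux_add_not_mem hv a)
  have hfs : ∀ W : AA H e, Submodule.comap H.subtype W.1 = S → ∀ a : H, v + a ∈ W.1 → f a = W := by
    intro W hW a ha
    apply Subtype.ext
    rw [eq_KK hd (aux_add_not_mem hv a) ha, hW]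
  have hle : ∀ W : AA H e, Submodule.comap H.subtype W.1 = S →
      Submodule.comap H.subtype (x.1 ⊓ W.1) = T ⊓ S := by
    intro W hW
    rw [Submodule.comap_inf, hW]
  have hinH : ∀ W : AA H e, Submodule.comap H.subtype W.1 = S → x.1 ⊓ W.1 ≤ H →
      Module.finrank F ↥(x.1 ⊓ W.1) = Module.finrank F ↥(T ⊓ S) := by
    intro W hW h
    rw [← hle W hW, finrank_comap_eq, inf_eq_left.2 h]
  have hnin : ∀ W : AA H e, Submodule.comap H.subtype W.1 = S → ¬ x.1 ⊓ W.1 ≤ H →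
      Module.finrank F ↥(x.1 ⊓ W.1) = Module.finrank F ↥(T ⊓ S) + 1 := by
    intro W hW h
    rw [finrank_A hd h, hle W hW]
  have hdle : Module.finrank F ↥(T ⊓ S) ≤ e := hT ▸ Submodule.finrank_mono inf_le_left
  unfold gg
  split_ifs with h1 h2
  · have hTS : T = S := by
      have a : T ⊓ S = T := Submodule.eq_of_le_of_finrank_eq inf_le_left (by omega)
      have b : T ⊓ S = S := Submodule.eq_of_le_of_finrank_eq inf_le_right (by omega)
      rw [← a, b]
    have hset : ((SimpleGraph.fromRel fun W₁ W₂ : AA H e =>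
        Module.finrank F ↥(W₁.1 ⊓ W₂.1) = e).neighborSet x ∩
        {W | Submodule.comap H.subtype W.1 = S}) = Set.range f \ {x} := by
      ext W
      rw [Set.mem_inter_iff, hadj]
      constructor
      · rintro ⟨⟨hne, -⟩, hW⟩
        refine ⟨?_, fun h => hne h.symm⟩
        obtain ⟨w, hwW, hw⟩ : ∃ w ∈ W.1, w ∉ H := by
          simpa [SetLike.le_def] using W.2.2
        obtain ⟨h, c, hwc⟩ := aux_decomp hd hw v
        refine ⟨(c * 0 : F) • h - h, hfs W hW _ ?_⟩
        have : v + (((c * 0 : F) • h - h : H) : V) = c • w := by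
          rw [hwc]; push_cast; module
        rw [this]; exact W.1.smul_mem _ hwW
      · rintro ⟨⟨a, rfl⟩, hne⟩
        refine ⟨⟨fun h => hne h.symm, ?_⟩, hfc a⟩
        by_cases h : x.1 ⊓ (f a).1 ≤ H
        · rw [hinH _ (hfc a) h, h1]
        · exfalso
          apply hne
          have h3 := hnin _ (hfc a) h
          have a1 := Submodule.eq_of_le_of_finrank_eq (inf_le_left : x.1 ⊓ (f a).1 ≤ x.1)
            (by rw [h3, h1, x.2.1])
          have b1 := Submodule.eq_of_le_of_finrank_eq (inf_le_right : x.1 ⊓ (f a).1 ≤ (f a).1)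
            (by rw [h3, h1, (f a).2.1])
          exact Subtype.ext (b1.symm.trans a1)
    have hxr : x ∈ Set.range f := ⟨0, hfs x hTS 0 (by simpa using hvx)⟩
    rw [hset, Set.ncard_sdiff_singleton_of_mem hxr, aux_range f S hf, hS, hH]
    congr 2; omega
  · have hset : ((SimpleGraph.fromRel fun W₁ W₂ : AA H e =>
        Module.finrank F ↥(W₁.1 ⊓ W₂.1) = e).neighborSet x ∩
        {W | Submodule.comap H.subtype W.1 = S}) = Set.range (fun t : T => f t) := by
      ext W
      rw [Set.mem_inter_iff, hadj]
      constructor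
      · rintro ⟨⟨-, hr⟩, hW⟩
        have hn : ¬ x.1 ⊓ W.1 ≤ H := by
          intro h; have := hinH W hW h; omega
        obtain ⟨w, ⟨hwx, hwW⟩, hw⟩ : ∃ w ∈ x.1 ⊓ W.1, w ∉ H := by
          simpa only [SetLike.le_def, not_forall, exists_prop] using hn
        obtain ⟨h, c, hwc⟩ := aux_decomp hd hw v
        have hvh : v + ((-h : H) : V) = c • w := by rw [hwc]; push_cast; module
        have hhT : -h ∈ T := by
          rw [hTdef, Submodule.mem_comap]
          have : H.subtype (-h) = c • w - v := by rw [← hvh]; simp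
          rw [this]; exact x.1.sub_mem (x.1.smul_mem _ hwx) hvx
        exact ⟨⟨-h, hhT⟩, hfs W hW _ (by rw [hvh]; exact W.1.smul_mem _ hwW)⟩
      · rintro ⟨t, rfl⟩
        have hn : ¬ x.1 ⊓ (f t).1 ≤ H := by
          intro h
          exact aux_add_not_mem hv t (h ⟨x.1.add_mem hvx t.2, self_mem_KK S _⟩)
        refine ⟨⟨?_, ?_⟩, hfc t⟩
        · intro h
          have : T = S := by rw [hTdef, h]; exact hfc t
          rw [this, inf_idem] at h1
          exact h1 hS
        · rw [hnin _ (hfc t) hn, h2]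
    rw [hset, aux_range (fun t : T => f t) (Submodule.comap T.subtype S)
      (by intro a b; rw [hf]; simp), finrank_comap_eq T S, inf_comm S T, hT]
    have : e - Module.finrank F ↥(T ⊓ S) = 1 := by omega
    rw [this, pow_one]
  · rw [Set.ncard_eq_zero]
    ext W
    rw [Set.mem_inter_iff, hadj]
    simp only [Set.mem_empty_iff_false, iff_false]
    rintro ⟨⟨-, hr⟩, hW⟩
    by_cases h : x.1 ⊓ W.1 ≤ H
    · have := hinH W hW h; omega
    · have := hnin W hW h; omega

end helpers

/-- `𝒞 = {C_U ∪ C_{σ(U)} : U ∈ Gr_e(H)}` is an equitable partition of the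
subgraph of the Grassmann graph `J_q(2e+1,e+1)` induced on
`A = {W ∈ Gr_{e+1}(V) : W ⊄ H}`, where for `U ∈ Gr_e(H)`,
`C_U = {W ∈ A : W ∩ H = U}` and `σ` is a polarity of the hyperplane `H`. -/
theorem stmt_3 {F : Type*} [Field F] [Fintype F]
    {V : Type*} [AddCommGroup V] [Module F V] [FiniteDimensional F V]
    (e : ℕ) (he : 1 ≤ e) (hV : Module.finrank F V = 2 * e + 1)
    (H : Submodule F V) (hH : Module.finrank F ↥H = 2 * e)
    (σ : Submodule F ↥H → Submodule F ↥H)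
    (hσinv : ∀ U, σ (σ U) = U)
    (hσanti : ∀ U U' : Submodule F ↥H, U ≤ U' → σ U' ≤ σ U) :
    IsEquitablePartition
      (SimpleGraph.fromRel
        fun W₁ W₂ : {W : Submodule F V // Module.finrank F ↥W = e + 1 ∧ ¬ W ≤ H} =>
          Module.finrank F ↥(W₁.1 ⊓ W₂.1) = e)
      {C | ∃ U : Submodule F ↥H, Module.finrank F ↥U = e ∧
        C = {W : {W : Submodule F V // Module.finrank F ↥W = e + 1 ∧ ¬ W ≤ H} |
          Submodule.comap H.subtype W.1 = U ∨ Submodule.comap H.subtype W.1 = σ U}} := by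
  have : Finite V := Module.finite_of_finite F
  have hd : Module.finrank F V = Module.finrank F H + 1 := by omega
  obtain ⟨hp1, hp2⟩ := aux_polarity σ hσinv hσanti
  have hcell : ∀ (U T : Submodule F H), (T = U ∨ T = σ U) → ∀ R, (R = U ∨ R = σ U) ↔
      (R = T ∨ R = σ T) := by
    rintro U T (rfl | rfl) R
    · rfl
    · rw [hσinv, or_comm]
  refine ⟨⟨?_, ?_⟩, ?_⟩
  · rintro ⟨U, hU, hC⟩
    obtain ⟨v, hv⟩ : ∃ v, v ∉ H := by
      by_contra! h
      rw [Submodule.eq_top_iff'.2 h, finrank_top] at hH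
      omega
    have : (⟨KK U v, by rw [finrank_KK hd U hv, hU], KK_not_le U hv⟩ : AA H e) ∈
        (∅ : Set (AA H e)) := by
      rw [hC]; exact Or.inl (comap_KK U hv)
    exact this
  · intro x
    have hx := finrank_A hd x.2.2
    rw [x.2.1] at hx
    refine ⟨_, ⟨⟨Submodule.comap H.subtype x.1, by omega, rfl⟩, Or.inl rfl⟩, ?_⟩
    rintro C ⟨⟨U, hU, rfl⟩, hxU⟩
    ext W
    exact hcell U _ hxU _
  · rintro C ⟨U, hU, rfl⟩ C' ⟨U', hU', rfl⟩
    have hσU : Module.finrank F (σ U) = e := by have := hp1 U; omega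
    have hσU' : Module.finrank F (σ U') = e := by have := hp1 U'; omega
    classical
    refine ⟨if U = σ U then gg (Fintype.card F) e (Module.finrank F ↥(U' ⊓ U)) else
      gg (Fintype.card F) e (Module.finrank F ↥(U' ⊓ U)) +
      gg (Fintype.card F) e (Module.finrank F ↥(U' ⊓ σ U)), ?_⟩
    intro x hx
    have c1 := count_nbrs e hd hH x U hU
    have c2 := count_nbrs e hd hH x (σ U) hσU
    have e1 := hp2 U' U (by omega)
    have e2 := hp2 U' (σ U) (by omega)
    rw [hσinv] at e2
    rw [Set.setOf_or, Set.inter_union_distrib_left]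
    split_ifs with h
    · rw [← h, Set.union_self, c1]
      rcases hx with hx | hx
      · rw [hx]
      · rw [hx, ← e1, ← h]
    · rw [Set.ncard_union_eq, c1, c2]
      · rcases hx with hx | hx
        · rw [hx]
        · rw [hx, e2, ← e1, add_comm]
      · rw [Set.disjoint_left]
        rintro W ⟨-, h1⟩ ⟨-, h2⟩
        exact h (Eq.trans (Eq.symm h1) h2)
end

section
/- For every U ∈ Gr_e(H) and every W ∈ D = Gr_{e+1}(H), the number of W_1 ∈ C_U ∪ C_{σ(U)} with dim(W_1 ∩ W) = e equals: |C_U ∪ C_{σ(U)}| if U + σ(U) ⊆ W; |C_U| if U ⊆ W and σ(U) ⊄ W; |C_{σ(U)}| if σ(U) ⊆ W and U ⊄ W; and 0 otherwise. In particular, this number always lies in {|C_U ∪ C_{σ(U)}|, |C_U ∪ C_{σ(U)}|/2, 0}. -/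
/-- `C_U = {W ∈ Gr_{e+1}(V) : W ⊄ H, W ∩ H = U}` for `U` a subspace of the hyperplane
`H` of `V`. -/
def CSet {F V : Type*} [Field F] [AddCommGroup V] [Module F V]
    (e : ℕ) (H : Submodule F V) (U : Submodule F ↥H) : Set (Submodule F V) :=
  {W | Module.finrank F ↥W = e + 1 ∧ ¬ W ≤ H ∧ Submodule.comap H.subtype W = U}

theorem finrank_map_sub {F V : Type*} [Field F] [AddCommGroup V] [Module F V]
    (H : Submodule F V) (U : Submodule F ↥H) :
    Module.finrank F ↥(Submodule.map H.subtype U) = Module.finrank F ↥U :=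
  (Submodule.equivMapOfInjective H.subtype H.injective_subtype U).finrank_eq.symm

theorem mem_CSet_iff {F V : Type*} [Field F] [AddCommGroup V] [Module F V]
    (e : ℕ) (H : Submodule F V) (U : Submodule F ↥H) (W : Submodule F V) :
    W ∈ CSet e H U ↔ Module.finrank F ↥W = e + 1 ∧ ¬ W ≤ H ∧
      W ⊓ H = Submodule.map H.subtype U := by
  unfold CSet
  have key : Submodule.comap H.subtype W = U ↔ W ⊓ H = Submodule.map H.subtype U := by
    rw [inf_comm, ← Submodule.map_comap_subtype]
    exact (Submodule.map_injective_of_injective H.injective_subtype).eq_iff.symm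
  simp only [Set.mem_ofPred_eq, key]

theorem polarity_finrank {F X : Type*} [Field F] [AddCommGroup X] [Module F X]
    [FiniteDimensional F X]
    (σ : Submodule F X → Submodule F X)
    (hσinv : ∀ U, σ (σ U) = U)
    (hσanti : ∀ U U' : Submodule F X, U ≤ U' → σ U' ≤ σ U) (U : Submodule F X) :
    Module.finrank F ↥(σ U) + Module.finrank F ↥U = Module.finrank F X := by
  let f : Submodule F X ≃o (Submodule F X)ᵒᵈ :=
    { toFun := fun U => OrderDual.toDual (σ U)
      invFun := fun U => σ (OrderDual.ofDual U)
      left_inv := fun U => hσinv U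
      right_inv := fun U => hσinv U
      map_rel_iff' := by
        intro a b
        constructor
        · intro h
          have := hσanti _ _ (show σ b ≤ σ a from h)
          rwa [hσinv, hσinv] at this
        · intro h
          exact hσanti _ _ h }
  have h := Order.coheight_orderIso f U
  have h2 : Order.coheight (f U) = Order.height (σ U) := rfl
  rw [h2, ← Module.length_submodule, ← Module.length_quotient, Module.length_eq_finrank,
    Module.length_eq_finrank] at h
  have h3 : Module.finrank F ↥(σ U) = Module.finrank F (X ⧸ U) := by exact_mod_cast h
  rw [h3]
  exact Submodule.finrank_quotient_add_finrank U

theorem CSet_count {F : Type*} [Field F] [Fintype F]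
    {V : Type*} [AddCommGroup V] [Module F V] [FiniteDimensional F V]
    (e : ℕ) (H : Submodule F V) (U : Submodule F ↥H) (hU : Module.finrank F ↥U = e) :
    ((H : Set V)ᶜ).ncard =
      (CSet e H U).ncard * (Fintype.card F ^ (e + 1) - Fintype.card F ^ e) := by
  classical
  have : Finite V := Module.finite_of_finite F
  have : Fintype V := Fintype.ofFinite V
  have : Finite (Submodule F V) := inferInstance
  have : Fintype (Submodule F V) := Fintype.ofFinite _
  set M := Submodule.map H.subtype U with hM
  have hMH : M ≤ H := Submodule.map_subtype_le H U
  have hMe : Module.finrank F ↥M = e := by rw [hM, finrank_map_sub, hU]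
  have hfr : ∀ v, v ∉ H → Module.finrank F ↥(M ⊔ Submodule.span F {v}) = e + 1 := by
    intro v hv
    rw [Submodule.finrank_sup_span_singleton (fun h => hv (hMH h)), hMe]
  rw [Set.ncard_eq_toFinset_card', Set.ncard_eq_toFinset_card',
    Finset.card_eq_sum_card_fiberwise (f := fun v => M ⊔ Submodule.span F {v})
      (t := (CSet e H U).toFinset), Finset.sum_const_nat]
  · intro W hW
    rw [Set.mem_toFinset, mem_CSet_iff] at hW
    obtain ⟨h1, h2, h3⟩ := hW
    have hMW : M ≤ W := by rw [hM, ← h3]; exact inf_le_left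
    have hset : {v ∈ ((H : Set V)ᶜ).toFinset | M ⊔ Submodule.span F {v} = W}
        = (W : Set V).toFinset \ (M : Set V).toFinset := by
      ext v
      simp only [Finset.mem_filter, Set.mem_toFinset, Set.mem_compl_iff, SetLike.mem_coe,
        Finset.mem_sdiff]
      constructor
      · rintro ⟨hv, rfl⟩
        exact ⟨Submodule.mem_sup_right (Submodule.mem_span_singleton_self v),
          fun h => hv (hMH h)⟩
      · rintro ⟨hv, hvM⟩
        have hvH : v ∉ H := by
          intro h
          apply hvM
          rw [hM, ← h3]
          exact ⟨hv, h⟩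
        refine ⟨hvH, ?_⟩
        apply Submodule.eq_of_le_of_finrank_eq
        · exact sup_le hMW (by simpa using hv)
        · rw [hfr v hvH, h1]
    rw [hset, Finset.card_sdiff_of_subset (by simpa using hMW)]
    have hc : ∀ N : Submodule F V, (N : Set V).toFinset.card
        = Fintype.card F ^ Module.finrank F ↥N := by
      intro N
      rw [← Module.card_eq_pow_finrank (K := F) (V := N), Set.toFinset_card]
      exact Fintype.card_congr (Equiv.refl _)
    rw [hc, hc, h1, hMe]
  · intro v hv
    have hv' : v ∉ H := by simpa using hv
    simp only [Set.coe_toFinset]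
    rw [mem_CSet_iff]
    refine ⟨hfr v hv', ?_, ?_⟩
    · intro h
      exact hv' (h (Submodule.mem_sup_right (Submodule.mem_span_singleton_self v)))
    · rw [sup_inf_assoc_of_le _ hMH]
      have : Submodule.span F {v} ⊓ H = ⊥ := by
        rw [← disjoint_iff, disjoint_comm]
        exact (Submodule.disjoint_span_singleton' (fun h => hv' (by rw [h]; exact H.zero_mem))).2 hv'
      rw [this, sup_bot_eq]

theorem CSet_card_eq {F : Type*} [Field F] [Fintype F]
    {V : Type*} [AddCommGroup V] [Module F V] [FiniteDimensional F V]
    (e : ℕ) (H : Submodule F V) (U U' : Submodule F ↥H) (hU : Module.finrank F ↥U = e)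
    (hU' : Module.finrank F ↥U' = e) : (CSet e H U).ncard = (CSet e H U').ncard := by
  have h1 := CSet_count e H U hU
  rw [CSet_count e H U' hU'] at h1
  have : 0 < Fintype.card F ^ (e + 1) - Fintype.card F ^ e :=
    Nat.sub_pos_of_lt (Nat.pow_lt_pow_right Fintype.one_lt_card (Nat.lt_succ_self e))
  exact (Nat.eq_of_mul_eq_mul_right this h1).symm

theorem inter_iff {F : Type*} [Field F]
    {V : Type*} [AddCommGroup V] [Module F V] [FiniteDimensional F V]
    (e : ℕ) (H : Submodule F V) (U : Submodule F ↥H) (hU : Module.finrank F ↥U = e)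
    (W W₁ : Submodule F V) (hWH : W ≤ H) (h : W₁ ∈ CSet e H U) :
    Module.finrank F ↥(W₁ ⊓ W) = e ↔ Submodule.map H.subtype U ≤ W := by
  obtain ⟨-, -, h3⟩ := (mem_CSet_iff e H U W₁).1 h
  have h4 : W₁ ⊓ W = Submodule.map H.subtype U ⊓ W := by
    rw [← h3, inf_assoc, inf_eq_right.2 hWH]
  have h5 := finrank_map_sub H U
  rw [hU] at h5
  rw [h4]
  constructor
  · intro h6
    have := Submodule.eq_of_le_of_finrank_eq
      (inf_le_left : Submodule.map H.subtype U ⊓ W ≤ _) (h6.trans h5.symm)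
    exact inf_eq_left.1 this
  · intro h6
    rw [inf_eq_left.2 h6, h5]

/-- For every `U ∈ Gr_e(H)` and every `W ∈ D = Gr_{e+1}(H)`, the number
`n` of `W₁ ∈ C_U ∪ C_{σ(U)}` with `dim (W₁ ∩ W) = e` equals `|C_U ∪ C_{σ(U)}|` if
`U + σ(U) ⊆ W`; `|C_U|` if `U ⊆ W` and `σ(U) ⊄ W`; `|C_{σ(U)}|` if `σ(U) ⊆ W` and
`U ⊄ W`; and `0` otherwise. In particular `n` always lies in
`{|C_U ∪ C_{σ(U)}|, |C_U ∪ C_{σ(U)}|/2, 0}`. -/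
theorem stmt_10 {F : Type*} [Field F] [Fintype F]
    {V : Type*} [AddCommGroup V] [Module F V] [FiniteDimensional F V]
    (q e : ℕ) (hq : Fintype.card F = q) (he : 1 ≤ e)
    (hV : Module.finrank F V = 2 * e + 1)
    (H : Submodule F V) (hH : Module.finrank F ↥H = 2 * e)
    (σ : Submodule F ↥H → Submodule F ↥H)
    (hσinv : ∀ U, σ (σ U) = U)
    (hσanti : ∀ U U' : Submodule F ↥H, U ≤ U' → σ U' ≤ σ U)
    (U : Submodule F ↥H) (hU : Module.finrank F ↥U = e)
    (W : Submodule F V) (hW : Module.finrank F ↥W = e + 1) (hWH : W ≤ H)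
    (n : ℕ)
    (hn : {W₁ ∈ CSet e H U ∪ CSet e H (σ U) |
      Module.finrank F ↥(W₁ ⊓ W) = e}.ncard = n) :
    (Submodule.map H.subtype (U ⊔ σ U) ≤ W →
      n = (CSet e H U ∪ CSet e H (σ U)).ncard) ∧
    (Submodule.map H.subtype U ≤ W ∧ ¬ Submodule.map H.subtype (σ U) ≤ W →
      n = (CSet e H U).ncard) ∧
    (¬ Submodule.map H.subtype U ≤ W ∧ Submodule.map H.subtype (σ U) ≤ W →
      n = (CSet e H (σ U)).ncard) ∧
    (¬ Submodule.map H.subtype U ≤ W ∧ ¬ Submodule.map H.subtype (σ U) ≤ W →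
      n = 0) ∧
    (n = (CSet e H U ∪ CSet e H (σ U)).ncard ∨
      2 * n = (CSet e H U ∪ CSet e H (σ U)).ncard ∨ n = 0) := by
  classical
  have hfin : Finite V := Module.finite_of_finite F
  have hfinS : Finite (Submodule F V) := inferInstance
  have hσU : Module.finrank F ↥(σ U) = e := by
    have := polarity_finrank σ hσinv hσanti U
    omega
  have iU := fun W₁ => inter_iff e H U hU W W₁ hWH
  have iS := fun W₁ => inter_iff e H (σ U) hσU W W₁ hWH
  have hcard := CSet_card_eq e H U (σ U) hU hσU
  have A : Submodule.map H.subtype U ≤ W → Submodule.map H.subtype (σ U) ≤ W →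
      n = (CSet e H U ∪ CSet e H (σ U)).ncard := by
    intro h1 h2
    rw [← hn]
    congr 1
    ext W₁
    have this' := iU W₁
    have := iS W₁
    simp only [Set.mem_ofPred_eq, Set.mem_union]
    clear * - h1 h2 this' this
    tauto
  have B : Submodule.map H.subtype U ≤ W → ¬ Submodule.map H.subtype (σ U) ≤ W →
      n = (CSet e H U).ncard := by
    intro h1 h2
    rw [← hn]
    congr 1
    ext W₁
    have this' := iU W₁
    have := iS W₁
    simp only [Set.mem_ofPred_eq, Set.mem_union]
    clear * - h1 h2 this' this
    tauto
  have C : ¬ Submodule.map H.subtype U ≤ W → Submodule.map H.subtype (σ U) ≤ W →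
      n = (CSet e H (σ U)).ncard := by
    intro h1 h2
    rw [← hn]
    congr 1
    ext W₁
    have this' := iU W₁
    have := iS W₁
    simp only [Set.mem_ofPred_eq, Set.mem_union]
    clear * - h1 h2 this' this
    tauto
  have D : ¬ Submodule.map H.subtype U ≤ W → ¬ Submodule.map H.subtype (σ U) ≤ W →
      n = 0 := by
    intro h1 h2
    rw [← hn, ← Set.ncard_empty (Submodule F V)]
    congr 1
    ext W₁
    have this' := iU W₁
    have := iS W₁
    simp only [Set.mem_ofPred_eq, Set.mem_union, Set.mem_empty_iff_false]
    clear * - h1 h2 this' this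
    tauto
  have E : U ≠ σ U → (CSet e H U ∪ CSet e H (σ U)).ncard
      = (CSet e H U).ncard + (CSet e H (σ U)).ncard := by
    intro hne
    refine Set.ncard_union_eq ?_ (Set.toFinite _) (Set.toFinite _)
    rw [Set.disjoint_left]
    rintro W₁ ⟨-, -, h1⟩ ⟨-, -, h2⟩
    exact hne (h1.symm.trans h2)
  refine ⟨?_, fun h => B h.1 h.2, fun h => C h.1 h.2, fun h => D h.1 h.2, ?_⟩
  · intro h
    rw [Submodule.map_sup] at h
    exact A (le_sup_left.trans h) (le_sup_right.trans h)
  · by_cases h1 : Submodule.map H.subtype U ≤ W <;>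
      by_cases h2 : Submodule.map H.subtype (σ U) ≤ W
    · exact Or.inl (A h1 h2)
    · have hne : U ≠ σ U := fun h => h2 (h ▸ h1)
      have := B h1 h2
      have := E hne
      omega
    · have hne : U ≠ σ U := fun h => h1 (by rw [h]; exact h2)
      have := C h1 h2
      have := E hne
      omega
    · exact Or.inr (Or.inr (D h1 h2))
end
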